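/- arXiv:1107.4914 — 2 statements merged into one kernel-verified Lean document; each statement's English description precedes it below -/
import Mathlib

section
/- Let E(t) = e^{−λt} ∑_{n=0}^∞ λⁿ I_n(t), where I_n(t) = ∫₀ᵗ dt₁ ⋯ ∫_{t_{n−1}}ᵗ dt_n ∏_{k=1}^{n+1} cosh(c(t_k − t_{k−1})) with t₀=0, t_{n+1}=t, and I₀(t)=cosh(ct). Then E satisfies E''(t) = −λ E'(t) + c² E(t) with E(0) = 1 and E'(0) = 0. -/
open Real MeasureTheory

/-- Iterated simplex integral with `s₀ = a`, `s_{n+1} = t`. -/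
noncomputable def iterInt (f : ℝ → ℝ) : ℕ → ℝ → ℝ → ℝ
  | 0, a, t => f (t - a)
  | n+1, a, t => ∫ s in a..t, f (s - a) * iterInt f n s t

/-- `I_n(t)`: simplex integral of products of hyperbolic cosines of increments. -/
noncomputable def I (c : ℝ) (n : ℕ) (t : ℝ) : ℝ :=
  iterInt (fun u => Real.cosh (c * u)) n 0 t

theorem iterInt_eq_sub (f : ℝ → ℝ) (n : ℕ) (a t : ℝ) :
    iterInt f n a t = iterInt f n 0 (t - a) := by
  induction n generalizing a t with
  | zero => simp [iterInt]
  | succ n ih =>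
    have h := intervalIntegral.integral_comp_sub_right (a := a) (b := t)
      (fun u => f u * iterInt f n 0 (t - a - u)) a
    simp only [sub_self] at h
    simp only [iterInt, sub_zero]
    rw [intervalIntegral.integral_congr
      (g := fun s => f (s - a) * iterInt f n 0 (t - a - (s - a))), h]
    · exact intervalIntegral.integral_congr fun u _ => by
        simp only [ih u (t - a)]
    · intro s _
      simp only [ih s t, sub_sub_sub_cancel_right]

theorem I_zero (c t : ℝ) : I c 0 t = cosh (c * t) := by
  simp [I, iterInt]

theorem I_succ (c : ℝ) (n : ℕ) (t : ℝ) :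
    I c (n + 1) t = ∫ s in (0 : ℝ)..t, cosh (c * (t - s)) * I c n s := by
  have h := intervalIntegral.integral_comp_sub_left (a := 0) (b := t)
    (fun u => cosh (c * (t - u)) * I c n u) t
  simp only [sub_self, sub_zero, sub_sub_cancel] at h
  rw [← h]
  simp only [I, iterInt, sub_zero]
  exact intervalIntegral.integral_congr fun s _ => by
    simp only [iterInt_eq_sub _ n s t]

/-- The analogue of `I` in which the last hyperbolic cosine is replaced by a hyperbolic sine. -/
noncomputable def sinhI (c : ℝ) : ℕ → ℝ → ℝ
  | 0, t => sinh (c * t)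
  | n + 1, t => ∫ s in (0 : ℝ)..t, sinh (c * (t - s)) * I c n s

theorem hasDerivAt_cosh_mul (c t : ℝ) :
    HasDerivAt (fun t => cosh (c * t)) (c * sinh (c * t)) t := by
  simpa [mul_comm] using ((hasDerivAt_id t).const_mul c).cosh

theorem hasDerivAt_sinh_mul (c t : ℝ) :
    HasDerivAt (fun t => sinh (c * t)) (c * cosh (c * t)) t := by
  simpa [mul_comm] using ((hasDerivAt_id t).const_mul c).sinh

section Convolution

variable {g : ℝ → ℝ}

theorem integral_cosh_mul_sub (hg : Continuous g) (c t : ℝ) :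
    ∫ s in (0 : ℝ)..t, cosh (c * (t - s)) * g s =
      cosh (c * t) * (∫ s in (0 : ℝ)..t, cosh (c * s) * g s)
        - sinh (c * t) * ∫ s in (0 : ℝ)..t, sinh (c * s) * g s := by
  rw [← intervalIntegral.integral_const_mul, ← intervalIntegral.integral_const_mul,
    ← intervalIntegral.integral_sub]
  · exact intervalIntegral.integral_congr fun s _ => by
      simp only [mul_sub, cosh_sub]; ring
  all_goals exact Continuous.intervalIntegrable (by fun_prop) _ _

theorem integral_sinh_mul_sub (hg : Continuous g) (c t : ℝ) :
    ∫ s in (0 : ℝ)..t, sinh (c * (t - s)) * g s =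
      sinh (c * t) * (∫ s in (0 : ℝ)..t, cosh (c * s) * g s)
        - cosh (c * t) * ∫ s in (0 : ℝ)..t, sinh (c * s) * g s := by
  rw [← intervalIntegral.integral_const_mul, ← intervalIntegral.integral_const_mul,
    ← intervalIntegral.integral_sub]
  · exact intervalIntegral.integral_congr fun s _ => by
      simp only [mul_sub, sinh_sub]; ring
  all_goals exact Continuous.intervalIntegrable (by fun_prop) _ _

theorem hasDerivAt_integral_cosh_mul_sub (hg : Continuous g) (c t : ℝ) :
    HasDerivAt (fun t => ∫ s in (0 : ℝ)..t, cosh (c * (t - s)) * g s)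
      (g t + c * ∫ s in (0 : ℝ)..t, sinh (c * (t - s)) * g s) t := by
  simp only [integral_cosh_mul_sub hg, integral_sinh_mul_sub hg]
  have hC : Continuous fun s => cosh (c * s) * g s := by fun_prop
  have hS : Continuous fun s => sinh (c * s) * g s := by fun_prop
  refine (((hasDerivAt_cosh_mul c t).mul (hC.integral_hasStrictDerivAt 0 t).hasDerivAt).sub
    ((hasDerivAt_sinh_mul c t).mul (hS.integral_hasStrictDerivAt 0 t).hasDerivAt)).congr_deriv ?_
  linear_combination g t * cosh_sq_sub_sinh_sq (c * t)

theorem hasDerivAt_integral_sinh_mul_sub (hg : Continuous g) (c t : ℝ) :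
    HasDerivAt (fun t => ∫ s in (0 : ℝ)..t, sinh (c * (t - s)) * g s)
      (c * ∫ s in (0 : ℝ)..t, cosh (c * (t - s)) * g s) t := by
  simp only [integral_cosh_mul_sub hg, integral_sinh_mul_sub hg]
  have hC : Continuous fun s => cosh (c * s) * g s := by fun_prop
  have hS : Continuous fun s => sinh (c * s) * g s := by fun_prop
  refine (((hasDerivAt_sinh_mul c t).mul (hC.integral_hasStrictDerivAt 0 t).hasDerivAt).sub
    ((hasDerivAt_cosh_mul c t).mul (hS.integral_hasStrictDerivAt 0 t).hasDerivAt)).congr_deriv ?_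
  ring

/-- Convolution with a kernel bounded by `M` improves a bound by `|s| ^ n / n!`. -/
theorem abs_integral_mul_le {k : ℝ → ℝ} (hk : Continuous k) (hg : Continuous g) {M B T t : ℝ}
    {n : ℕ} (hkM : ∀ u, |u| ≤ T → |k u| ≤ M) (hM : 0 ≤ M)
    (hgB : ∀ s, |s| ≤ T → |g s| ≤ B * (|s| ^ n / n.factorial)) (ht : |t| ≤ T) :
    |∫ s in (0 : ℝ)..t, k (t - s) * g s| ≤ M * B * (|t| ^ (n + 1) / (n + 1).factorial) := by
  have hle : ∀ s ∈ Set.uIoc 0 t, |s| ≤ |t| ∧ |t - s| ≤ |t| := by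
    intro s hs
    rcases Set.mem_uIoc.1 hs with h | h
    · rw [abs_of_pos h.1, abs_of_pos (h.1.trans_le h.2), abs_of_nonneg (by linarith)]
      exact ⟨h.2, by linarith⟩
    · rw [abs_of_nonpos h.2, abs_of_neg (h.1.trans_le h.2), abs_of_neg (by linarith)]
      exact ⟨by linarith, by linarith⟩
  have hpow := integral_pow_abs_sub_uIoc (a := 0) (b := t) n
  simp only [sub_zero] at hpow
  calc |∫ s in (0 : ℝ)..t, k (t - s) * g s|
      ≤ ∫ s in Set.uIoc 0 t, ‖k (t - s) * g s‖ := by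
        rw [← Real.norm_eq_abs]
        exact intervalIntegral.norm_integral_le_integral_norm_uIoc
    _ ≤ ∫ s in Set.uIoc 0 t, M * B / n.factorial * |s| ^ n := by
        refine setIntegral_mono_on ?_ ?_ measurableSet_uIoc fun s hs => ?_
        · exact (Continuous.intervalIntegrable (by fun_prop) 0 t).def'
        · exact (Continuous.intervalIntegrable (by fun_prop) 0 t).def'
        · obtain ⟨h1, h2⟩ := hle s hs
          rw [norm_mul]
          calc |k (t - s)| * |g s| ≤ M * (B * (|s| ^ n / n.factorial)) :=
                mul_le_mul (hkM _ (h2.trans ht)) (hgB s (h1.trans ht)) (abs_nonneg _) hM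
            _ = M * B / n.factorial * |s| ^ n := by ring
    _ = M * B * (|t| ^ (n + 1) / (n + 1).factorial) := by
        rw [integral_const_mul, hpow, Nat.factorial_succ]
        push_cast
        field_simp

end Convolution

theorem continuous_I (c : ℝ) (n : ℕ) : Continuous (I c n) := by
  induction n with
  | zero => simp only [funext (I_zero c)]; fun_prop
  | succ n ih =>
    rw [funext (I_succ c n)]
    exact continuous_iff_continuousAt.2 fun t =>
      (hasDerivAt_integral_cosh_mul_sub ih c t).continuousAt

theorem hasDerivAt_I_zero (c t : ℝ) : HasDerivAt (I c 0) (c * sinhI c 0 t) t := by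
  rw [funext (I_zero c)]
  exact hasDerivAt_cosh_mul c t

theorem hasDerivAt_I_succ (c : ℝ) (n : ℕ) (t : ℝ) :
    HasDerivAt (I c (n + 1)) (I c n t + c * sinhI c (n + 1) t) t := by
  rw [funext (I_succ c n)]
  exact hasDerivAt_integral_cosh_mul_sub (continuous_I c n) c t

theorem hasDerivAt_sinhI (c : ℝ) (n : ℕ) (t : ℝ) :
    HasDerivAt (sinhI c n) (c * I c n t) t := by
  cases n with
  | zero =>
    rw [I_zero]
    exact hasDerivAt_sinh_mul c t
  | succ n =>
    rw [I_succ]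
    exact hasDerivAt_integral_sinh_mul_sub (continuous_I c n) c t

theorem abs_cosh_mul_le {c u T : ℝ} (hu : |u| ≤ T) : |cosh (c * u)| ≤ cosh (c * T) := by
  rw [abs_of_pos (cosh_pos _), cosh_le_cosh, abs_mul, abs_mul]
  exact mul_le_mul_of_nonneg_left (hu.trans (le_abs_self T)) (abs_nonneg c)

theorem abs_sinh_mul_le {c u T : ℝ} (hu : |u| ≤ T) : |sinh (c * u)| ≤ cosh (c * T) := by
  refine le_trans ?_ (abs_cosh_mul_le hu)
  rw [← sq_le_sq, sinh_sq]
  linarith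

theorem abs_I_le (c : ℝ) {T : ℝ} (n : ℕ) {t : ℝ} (ht : |t| ≤ T) :
    |I c n t| ≤ cosh (c * T) ^ (n + 1) * (|t| ^ n / n.factorial) := by
  induction n generalizing t with
  | zero => simpa [I_zero] using abs_cosh_mul_le ht
  | succ n ih =>
    rw [I_succ, pow_succ']
    exact abs_integral_mul_le (k := fun u => cosh (c * u)) (by fun_prop) (continuous_I c n)
      (fun u hu => abs_cosh_mul_le hu) (cosh_pos _).le (fun s hs => ih hs) ht

theorem abs_sinhI_le (c : ℝ) {T : ℝ} (n : ℕ) {t : ℝ} (ht : |t| ≤ T) :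
    |sinhI c n t| ≤ cosh (c * T) ^ (n + 1) * (|t| ^ n / n.factorial) := by
  cases n with
  | zero => simpa [sinhI] using abs_sinh_mul_le ht
  | succ n =>
    rw [pow_succ']
    exact abs_integral_mul_le (k := fun u => sinh (c * u)) (by fun_prop) (continuous_I c n)
      (fun u hu => abs_sinh_mul_le hu) (cosh_pos _).le (fun s hs => abs_I_le c n hs) ht

/-- On `|t| ≤ T` the terms `lamⁿ I_n(t)` and `lamⁿ sinhI_n(t)` are dominated by one summable
sequence. -/
theorem exists_summable_bound (lam c T : ℝ) :
    ∃ u : ℕ → ℝ, Summable u ∧ ∀ n t, |t| ≤ T →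
      |lam ^ n * I c n t| ≤ u n ∧ |lam ^ n * sinhI c n t| ≤ u n := by
  refine ⟨fun n => cosh (c * T) * ((|lam| * cosh (c * T) * T) ^ n / n.factorial),
    (summable_pow_div_factorial _).mul_left _, fun n t ht => ?_⟩
  have key : ∀ x : ℝ, |x| ≤ cosh (c * T) ^ (n + 1) * (|t| ^ n / n.factorial) →
      |lam ^ n * x| ≤ cosh (c * T) * ((|lam| * cosh (c * T) * T) ^ n / n.factorial) := by
    intro x hx
    have hcosh := (cosh_pos (c * T)).le
    calc |lam ^ n * x| ≤ |lam| ^ n * (cosh (c * T) ^ (n + 1) * (T ^ n / n.factorial)) := by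
          rw [abs_mul, abs_pow]
          gcongr
          exact hx.trans (by gcongr)
      _ = _ := by rw [mul_pow, mul_pow]; ring
  exact ⟨key _ (abs_I_le c n ht), key _ (abs_sinhI_le c n ht)⟩

theorem summable_pow_mul_I (lam c t : ℝ) : Summable fun n => lam ^ n * I c n t := by
  obtain ⟨u, hu, h⟩ := exists_summable_bound lam c |t|
  exact hu.of_norm_bounded fun n => (h n t le_rfl).1

theorem summable_pow_mul_sinhI (lam c t : ℝ) : Summable fun n => lam ^ n * sinhI c n t := by
  obtain ⟨u, hu, h⟩ := exists_summable_bound lam c |t|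
  exact hu.of_norm_bounded fun n => (h n t le_rfl).2

theorem hasDerivAt_tsum_sinhI (lam c t : ℝ) :
    HasDerivAt (fun t => ∑' n, lam ^ n * sinhI c n t) (c * ∑' n, lam ^ n * I c n t) t := by
  obtain ⟨u, hu, h⟩ := exists_summable_bound lam c (|t| + 1)
  have hmem : t ∈ Metric.ball (0 : ℝ) (|t| + 1) := by simp
  have hd := hasDerivAt_tsum_of_isPreconnected (hu.mul_left |c|) Metric.isOpen_ball
    (convex_ball (0 : ℝ) (|t| + 1)).isPreconnected
    (fun n y _ => (hasDerivAt_sinhI c n y).const_mul (lam ^ n))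
    (fun n y hy => ?_) hmem (summable_pow_mul_sinhI lam c t) hmem
  · refine hd.congr_deriv ?_
    rw [← tsum_mul_left]
    exact tsum_congr fun n => by ring
  · rw [mul_left_comm, norm_mul]
    exact mul_le_mul_of_nonneg_left (h n y (mem_ball_zero_iff.1 hy).le).1 (abs_nonneg c)

theorem hasDerivAt_tsum_I (lam c t : ℝ) :
    HasDerivAt (fun t => ∑' n, lam ^ n * I c n t)
      (lam * (∑' n, lam ^ n * I c n t) + c * ∑' n, lam ^ n * sinhI c n t) t := by
  obtain ⟨u, hu, h⟩ := exists_summable_bound lam c (|t| + 1)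
  have hmem : t ∈ Metric.ball (0 : ℝ) (|t| + 1) := by simp
  have hd := hasDerivAt_tsum_of_isPreconnected
    (g := fun n t => lam ^ (n + 1) * I c (n + 1) t)
    ((hu.mul_left |lam|).add (((summable_nat_add_iff 1).2 hu).mul_left |c|)) Metric.isOpen_ball
    (convex_ball (0 : ℝ) (|t| + 1)).isPreconnected
    (fun n y _ => (hasDerivAt_I_succ c n y).const_mul (lam ^ (n + 1)))
    (fun n y hy => ?_) hmem ((summable_nat_add_iff 1).2 (summable_pow_mul_I lam c t)) hmem
  · have hS := summable_pow_mul_sinhI lam c t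
    have hfun : (fun t => ∑' n, lam ^ n * I c n t) =
        fun t => lam ^ 0 * I c 0 t + ∑' n, lam ^ (n + 1) * I c (n + 1) t :=
      funext fun s => (summable_pow_mul_I lam c s).tsum_eq_zero_add
    rw [hfun]
    refine (((hasDerivAt_I_zero c t).const_mul (lam ^ 0)).add hd).congr_deriv ?_
    rw [hS.tsum_eq_zero_add, mul_add, ← tsum_mul_left, ← tsum_mul_left, add_left_comm,
      ← ((summable_pow_mul_I lam c t).mul_left lam).tsum_add
        (((summable_nat_add_iff 1).2 hS).mul_left c)]
    congr 1
    · ring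
    · exact tsum_congr fun n => by ring
  · have hy' : |y| ≤ |t| + 1 := (mem_ball_zero_iff.1 hy).le
    calc ‖lam ^ (n + 1) * (I c n y + c * sinhI c (n + 1) y)‖
        = ‖lam * (lam ^ n * I c n y) + c * (lam ^ (n + 1) * sinhI c (n + 1) y)‖ := by
          congr 1; ring
      _ ≤ |lam| * |lam ^ n * I c n y| + |c| * |lam ^ (n + 1) * sinhI c (n + 1) y| := by
          rw [← abs_mul, ← abs_mul]; exact abs_add_le _ _
      _ ≤ |lam| * u n + |c| * u (n + 1) := by
          gcongr
          exacts [(h n y hy').1, (h (n + 1) y hy').2]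

theorem I_apply_zero (c : ℝ) (n : ℕ) : I c n 0 = if n = 0 then 1 else 0 := by
  cases n with
  | zero => simp [I_zero]
  | succ n => simp [I_succ]

theorem sinhI_apply_zero (c : ℝ) (n : ℕ) : sinhI c n 0 = 0 := by
  cases n <;> simp [sinhI]

/-- the mean hyperbolic distance `E(t) = e^{-λt} ∑ λⁿ I_n(t)`
satisfies `E'' = -λ E' + c² E`, `E(0) = 1`, `E'(0) = 0`. -/
theorem mean_hyperbolic_distance_ode (lam c : ℝ) (hlam : 0 < lam) (hc : 0 < c)
    (E : ℝ → ℝ) (hE : ∀ t, E t = Real.exp (-lam * t) * ∑' n : ℕ, lam ^ n * I c n t) :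
    (∀ t, 0 < t → deriv (deriv E) t = -lam * deriv E t + c^2 * E t)
      ∧ E 0 = 1 ∧ deriv E 0 = 0 := by
  have hexp : ∀ t, HasDerivAt (fun t => exp (-lam * t)) (-lam * exp (-lam * t)) t := fun t => by
    simpa [mul_comm] using ((hasDerivAt_id t).const_mul (-lam)).exp
  have hE' : deriv E = fun t => c * (exp (-lam * t) * ∑' n, lam ^ n * sinhI c n t) := by
    funext t
    rw [funext hE]
    refine (((hexp t).mul (hasDerivAt_tsum_I lam c t)).congr_deriv ?_).deriv
    ring
  refine ⟨fun t _ => ?_, ?_, ?_⟩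
  · rw [hE', hE t]
    refine ((((hexp t).mul (hasDerivAt_tsum_sinhI lam c t)).const_mul c).congr_deriv ?_).deriv
    ring
  · simp [hE, I_apply_zero]
  · simp [hE', sinhI_apply_zero]
end

section
/- Let E_n(t) = (n!/tⁿ) ∫₀ᵗ dt₁ ⋯ ∫_{t_{n−1}}ᵗ dt_n ∏_{k=1}^{n+1} cosh(c(t_k−t_{k−1})) with t₀=0, t_{n+1}=t. Then for n ≥ 1, E_n(t) = ∑_{r=0}^{⌊n/2⌋} 2^{−n} n!/(n−2r)! ∑_{j=0}^∞ C(r+j,j) (ct)^{2j}/(2r+2j)! + ∑_{r=0}^{⌊(n−1)/2⌋} 2^{−n} n!/(n−2r−1)! ∑_{j=0}^∞ C(r+j,j) (ct)^{2j}/(2r+2j+1)!. -/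
open Real MeasureTheory

/-- Conditional mean hyperbolic distance given `n` changes of direction:
`E_n(t) = (n!/tⁿ) ∫₀ᵗ dt₁ ⋯ ∫_{t_{n-1}}ᵗ dt_n ∏_{k=1}^{n+1} cosh(c(t_k - t_{k-1}))`. -/
noncomputable def En (c : ℝ) (n : ℕ) (t : ℝ) : ℝ :=
  (n.factorial : ℝ) / t ^ n * iterInt (fun u => Real.cosh (c * u)) n 0 t

open Finset in
/-- Splitting a sum over an initial segment of `ℕ` by parity. -/
lemma sum_range_eq_even_add_odd (f : ℕ → ℝ) (N : ℕ) :
    ∑ k ∈ range N, f k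
      = ∑ r ∈ range ((N + 1) / 2), f (2 * r) + ∑ r ∈ range (N / 2), f (2 * r + 1) := by
  induction N with
  | zero => simp
  | succ N ih =>
    rw [sum_range_succ, ih]
    rcases Nat.even_or_odd' N with ⟨p, rfl | rfl⟩
    · have h1 : (2 * p + 1) / 2 = p := by omega
      have h2 : (2 * p + 1 + 1) / 2 = p + 1 := by omega
      have h3 : 2 * p / 2 = p := by omega
      rw [h1, h2, h3, sum_range_succ]
      ring
    · have h1 : (2 * p + 1) / 2 = p := by omega
      have h2 : (2 * p + 1 + 1) / 2 = p + 1 := by omega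
      have h3 : (2 * p + 1 + 1 + 1) / 2 = p + 1 := by omega
      rw [h1, h2, h3, sum_range_succ (fun r => f (2 * r + 1))]
      ring

section Combinatorics

open PowerSeries

/-- The generating function of `k ↦ C(⌊k/2⌋ + m, m)`. -/
lemma mk_choose_half_mul (m : ℕ) :
    (PowerSeries.mk fun k => (((k / 2 + m).choose m : ℕ) : ℤ)) * ((1 + X) ^ m * (1 - X) ^ (m + 1))
      = 1 := by
  induction m with
  | zero =>
    have h := PowerSeries.mk_one_mul_one_sub_eq_one ℤ
    simp only [Pi.one_def] at h
    simpa using h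
  | succ m ih =>
    have key : (PowerSeries.mk fun k => (((k / 2 + (m + 1)).choose (m + 1) : ℕ) : ℤ))
        * (1 - X ^ 2) = PowerSeries.mk fun k => (((k / 2 + m).choose m : ℕ) : ℤ) := by
      ext k
      rw [mul_sub, mul_one, map_sub, coeff_mul_X_pow', coeff_mk, coeff_mk]
      split_ifs with hk
      · rw [coeff_mk]
        obtain ⟨k, rfl⟩ := Nat.exists_eq_add_of_le' hk
        have h1 : (k + 2) / 2 = k / 2 + 1 := by omega
        rw [Nat.add_sub_cancel, h1,
          show k / 2 + 1 + (m + 1) = (k / 2 + 1 + m) + 1 by ring, Nat.choose_succ_succ,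
          show k / 2 + 1 + m = k / 2 + (m + 1) by ring]
        push_cast
        ring
      · have h1 : k / 2 = 0 := by omega
        simp [h1]
    calc _ = ((PowerSeries.mk fun k => (((k / 2 + (m + 1)).choose (m + 1) : ℕ) : ℤ))
        * (1 - X ^ 2)) * ((1 + X) ^ m * (1 - X) ^ (m + 1)) := by ring
      _ = 1 := by rw [key, ih]

lemma mk_choose_half_mul_one_add_pow (m : ℕ) :
    (PowerSeries.mk fun k => (((k / 2 + m).choose m : ℕ) : ℤ)) * (1 + X) ^ m
      = PowerSeries.mk fun k => (((m + k).choose m : ℕ) : ℤ) := by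
  have h2 : (PowerSeries.mk fun k => (((m + k).choose m : ℕ) : ℤ)) * (1 - X) ^ (m + 1) = 1 := by
    rw [← PowerSeries.mk_one_pow_eq_mk_choose_add, ← mul_pow,
      PowerSeries.mk_one_mul_one_sub_eq_one, one_pow]
  calc _ = ((PowerSeries.mk fun k => (((k / 2 + m).choose m : ℕ) : ℤ)) * (1 + X) ^ m)
        * ((PowerSeries.mk fun k => (((m + k).choose m : ℕ) : ℤ)) * (1 - X) ^ (m + 1)) := by
        rw [h2, mul_one]
    _ = ((PowerSeries.mk fun k => (((k / 2 + m).choose m : ℕ) : ℤ))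
          * ((1 + X) ^ m * (1 - X) ^ (m + 1)))
        * PowerSeries.mk fun k => (((m + k).choose m : ℕ) : ℤ) := by ring
    _ = _ := by rw [mk_choose_half_mul, one_mul]

lemma coeff_one_add_X_pow_int (N k : ℕ) :
    coeff k ((1 + X : PowerSeries ℤ) ^ N) = (N.choose k : ℤ) := by
  have h : ((1 + X : PowerSeries ℤ) ^ N)
      = (((1 + Polynomial.X) ^ N : Polynomial ℤ) : PowerSeries ℤ) := by
    simp
  rw [h, Polynomial.coeff_coe, Polynomial.coeff_one_add_X_pow]

lemma sum_choose_half_mul_choose (n m : ℕ) :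
    ∑ k ∈ Finset.range (n + 1), (k / 2 + m).choose m * (n + 2 * m).choose (n - k)
      = 2 ^ n * (n + m).choose m := by
  have h : (PowerSeries.mk fun k => (((k / 2 + m).choose m : ℕ) : ℤ)) * (1 + X) ^ (n + 2 * m)
      = (PowerSeries.mk fun k => (((m + k).choose m : ℕ) : ℤ)) * (1 + X) ^ (n + m) := by
    rw [← mk_choose_half_mul_one_add_pow]
    ring
  have h := congrArg (coeff n) h
  simp only [coeff_mul, coeff_mk, coeff_one_add_X_pow_int] at h
  rw [Finset.Nat.sum_antidiagonal_eq_sum_range_succ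
      (fun i j => (((i / 2 + m).choose m : ℕ) : ℤ) * ((n + 2 * m).choose j : ℤ)),
    Finset.Nat.sum_antidiagonal_eq_sum_range_succ
      (fun i j => (((m + i).choose m : ℕ) : ℤ) * ((n + m).choose j : ℤ))] at h
  have h' : ∑ k ∈ Finset.range (n + 1), (k / 2 + m).choose m * (n + 2 * m).choose (n - k)
      = ∑ k ∈ Finset.range (n + 1), (m + k).choose m * (n + m).choose (n - k) := by
    exact_mod_cast h
  rw [h', ← Nat.sum_range_choose, Finset.sum_mul]
  refine Finset.sum_congr rfl fun k hk => ?_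
  have hk : k ≤ n := Nat.lt_succ_iff.mp (Finset.mem_range.mp hk)
  have e1 : (n + m).choose (n - k) = (n + m).choose (m + k) := by
    rw [← Nat.choose_symm (show m + k ≤ n + m by omega)]
    congr 1
    omega
  have e2 := Nat.choose_mul (n := n + m) (k := m + k) (s := m) (by omega)
  rw [e1, mul_comm, e2, Nat.add_sub_cancel, Nat.add_sub_cancel_left, mul_comm]

/-- The coefficient identity behind the series expansion. -/
lemma sum_choose_half_div_factorial (n m : ℕ) :
    ∑ k ∈ Finset.range (n + 1), ((k / 2 + m).choose m : ℝ)
        / (((n - k).factorial : ℝ) * ((k + 2 * m).factorial : ℝ))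
      = 2 ^ n * ((n + m).choose m : ℝ) / ((n + 2 * m).factorial : ℝ) := by
  have h : (∑ k ∈ Finset.range (n + 1), ((k / 2 + m).choose m : ℝ) * ((n + 2 * m).choose (n - k) : ℝ))
      = 2 ^ n * ((n + m).choose m : ℝ) := by
    exact_mod_cast sum_choose_half_mul_choose n m
  rw [← h, Finset.sum_div]
  refine Finset.sum_congr rfl fun k hk => ?_
  have hk : k ≤ n := Nat.lt_succ_iff.mp (Finset.mem_range.mp hk)
  rw [Nat.cast_choose ℝ (show n - k ≤ n + 2 * m by omega),
    show n + 2 * m - (n - k) = k + 2 * m by omega]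
  have := Nat.cast_ne_zero (R := ℝ) |>.mpr (Nat.factorial_ne_zero (n + 2 * m))
  field_simp

end Combinatorics

section Series

lemma norm_choose_mul_pow_div_factorial_le (n q m : ℕ) (y : ℝ) :
    ‖((n + m).choose m : ℝ) * y ^ (2 * m) / ((q + 2 * m).factorial : ℝ)‖
      ≤ 2 ^ n * ((2 * y ^ 2) ^ m / (m.factorial : ℝ)) := by
  have h1 : ((n + m).choose m : ℝ) ≤ 2 ^ (n + m) := by
    exact_mod_cast Nat.choose_le_two_pow (n + m) m
  have h2 : (m.factorial : ℝ) ≤ ((q + 2 * m).factorial : ℝ) := by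
    exact_mod_cast Nat.factorial_le (by omega)
  have h3 : 0 < (m.factorial : ℝ) := by exact_mod_cast Nat.factorial_pos m
  have h4 : 0 ≤ y ^ (2 * m) := by rw [pow_mul]; positivity
  rw [Real.norm_of_nonneg (by positivity)]
  calc _ ≤ 2 ^ (n + m) * y ^ (2 * m) / (m.factorial : ℝ) := by gcongr
    _ = _ := by rw [mul_pow, pow_add, pow_mul]; ring

lemma summable_choose_mul_pow_div_factorial (n q : ℕ) (y : ℝ) :
    Summable fun m : ℕ => ((n + m).choose m : ℝ) * y ^ (2 * m) / ((q + 2 * m).factorial : ℝ) :=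
  .of_norm_bounded ((Real.summable_pow_div_factorial _).mul_left _)
    fun m => norm_choose_mul_pow_div_factorial_le n q m y

/-- The series `∑ₘ C(n+m, m) c²ᵐ u^(q+2m) / (q+2m)!`; with `q = n` it is the `(n+1)`-fold
convolution power of `u ↦ cosh (c u)`. -/
noncomputable def coshSeries (c : ℝ) (n q : ℕ) (u : ℝ) : ℝ :=
  ∑' m : ℕ, ((n + m).choose m : ℝ) * c ^ (2 * m) * u ^ (q + 2 * m) / ((q + 2 * m).factorial : ℝ)

lemma coshSeries_term_eq (c : ℝ) (n q m : ℕ) (u : ℝ) :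
    ((n + m).choose m : ℝ) * c ^ (2 * m) * u ^ (q + 2 * m) / ((q + 2 * m).factorial : ℝ)
      = u ^ q * (((n + m).choose m : ℝ) * (c * u) ^ (2 * m) / ((q + 2 * m).factorial : ℝ)) := by
  rw [mul_pow, pow_add]
  ring

lemma summable_coshSeries (c : ℝ) (n q : ℕ) (u : ℝ) :
    Summable fun m : ℕ =>
      ((n + m).choose m : ℝ) * c ^ (2 * m) * u ^ (q + 2 * m) / ((q + 2 * m).factorial : ℝ) := by
  simp only [coshSeries_term_eq]
  exact (summable_choose_mul_pow_div_factorial n q (c * u)).mul_left _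

lemma coshSeries_eq_pow_mul (c : ℝ) (n q : ℕ) (u : ℝ) :
    coshSeries c n q u = u ^ q *
      ∑' m : ℕ, ((n + m).choose m : ℝ) * (c * u) ^ (2 * m) / ((q + 2 * m).factorial : ℝ) := by
  simp only [coshSeries, coshSeries_term_eq, tsum_mul_left]

lemma coshSeries_succ_zero (c : ℝ) (n q : ℕ) : coshSeries c n (q + 1) 0 = 0 := by
  simp [coshSeries_eq_pow_mul]

lemma coshSeries_zero_zero (c u : ℝ) : coshSeries c 0 0 u = Real.cosh (c * u) := by
  rw [coshSeries_eq_pow_mul, ← (Real.hasSum_cosh (c * u)).tsum_eq]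
  simp

lemma hasDerivAt_coshSeries (c : ℝ) (n q : ℕ) (u : ℝ) :
    HasDerivAt (coshSeries c n (q + 1)) (coshSeries c n q u) u := by
  set R := |u| + 1
  have hsum : Summable fun m : ℕ =>
      R ^ q * (2 ^ n * ((2 * (c * R) ^ 2) ^ m / (m.factorial : ℝ))) :=
    ((Real.summable_pow_div_factorial _).mul_left _).mul_left _
  refine hasDerivAt_tsum_of_isPreconnected (g := fun m u =>
      ((n + m).choose m : ℝ) * c ^ (2 * m) * u ^ (q + 1 + 2 * m) / ((q + 1 + 2 * m).factorial : ℝ))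
    (g' := fun m u =>
      ((n + m).choose m : ℝ) * c ^ (2 * m) * u ^ (q + 2 * m) / ((q + 2 * m).factorial : ℝ))
    hsum (t := Metric.ball 0 R) (y₀ := u) Metric.isOpen_ball
    (convex_ball (0 : ℝ) R).isPreconnected ?_ ?_ ?_ (summable_coshSeries c n (q + 1) u) ?_
  · intro m y _
    have h := ((hasDerivAt_pow (q + 1 + 2 * m) y).const_mul
      (((n + m).choose m : ℝ) * c ^ (2 * m))).div_const ((q + 1 + 2 * m).factorial : ℝ)
    refine h.congr_deriv ?_
    rw [show q + 1 + 2 * m = q + 2 * m + 1 by ring, Nat.add_sub_cancel, Nat.factorial_succ]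
    have := Nat.cast_ne_zero (R := ℝ) |>.mpr (Nat.factorial_ne_zero (q + 2 * m))
    have : ((q + 2 * m + 1 : ℕ) : ℝ) ≠ 0 := by positivity
    rw [Nat.cast_mul]
    field_simp
  · intro m y hy
    have hy : |y| ≤ R := by simpa using (mem_ball_zero_iff.mp hy).le
    rw [coshSeries_term_eq, norm_mul]
    have h0 : (c * y) ^ 2 ≤ (c * R) ^ 2 := by
      rw [mul_pow, mul_pow, ← sq_abs y]
      gcongr
    have h1 : ‖y ^ q‖ ≤ R ^ q := by
      rw [norm_pow, Real.norm_eq_abs]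
      gcongr
    have h2 := norm_choose_mul_pow_div_factorial_le n q m (c * y)
    refine mul_le_mul h1 (h2.trans ?_) (norm_nonneg _) (by positivity)
    gcongr
  · simp [R]
  · simp [R]

lemma coshSeries_succ_sub (c : ℝ) (n q : ℕ) (u : ℝ) :
    coshSeries c (n + 1) q u - c ^ 2 * coshSeries c (n + 1) (q + 2) u = coshSeries c n q u := by
  have h1 := summable_coshSeries c (n + 1) q u
  have h2 := summable_coshSeries c n q u
  have h3 := (summable_coshSeries c (n + 1) (q + 2) u).mul_left (c ^ 2)
  unfold coshSeries
  rw [h1.tsum_eq_zero_add, h2.tsum_eq_zero_add, ← tsum_mul_left, sub_eq_iff_eq_add,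
    add_assoc (_ : ℝ),
    ← ((summable_nat_add_iff 1).mpr h2).tsum_add h3]
  congr 1
  · simp
  · refine tsum_congr fun m => ?_
    rw [show q + 2 + 2 * m = q + 2 * (m + 1) by ring,
      show n + 1 + (m + 1) = (n + (m + 1)) + 1 by ring, Nat.choose_succ_succ,
      show n + (m + 1) = n + 1 + m by ring]
    push_cast
    ring

lemma continuous_coshSeries_self (c : ℝ) (n : ℕ) : Continuous (coshSeries c n n) := by
  cases n with
  | zero =>
    rw [show coshSeries c 0 0 = fun u => Real.cosh (c * u) from funext (coshSeries_zero_zero c)]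
    fun_prop
  | succ n =>
    exact continuous_iff_continuousAt.mpr fun u => (hasDerivAt_coshSeries c (n + 1) n u).continuousAt

/-- Convolution with `cosh` raises the index of the series. -/
lemma integral_cosh_mul_coshSeries (c : ℝ) (n : ℕ) (a t : ℝ) :
    ∫ s in a..t, Real.cosh (c * (s - a)) * coshSeries c n n (t - s)
      = coshSeries c (n + 1) (n + 1) (t - a) := by
  have hder : ∀ s ∈ Set.uIcc a t, HasDerivAt
      (fun s => -(Real.cosh (c * (s - a)) * coshSeries c (n + 1) (n + 1) (t - s)
        + c * Real.sinh (c * (s - a)) * coshSeries c (n + 1) (n + 2) (t - s)))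
      (Real.cosh (c * (s - a)) * coshSeries c n n (t - s)) s := by
    intro s _
    have hl : HasDerivAt (fun s : ℝ => c * (s - a)) c s := by
      simpa using ((hasDerivAt_id s).sub_const a).const_mul c
    have hr : HasDerivAt (fun s : ℝ => t - s) (-1) s := by
      simpa using (hasDerivAt_id s).const_sub t
    have h1 := (hasDerivAt_coshSeries c (n + 1) n (t - s)).comp s hr
    have h2 := (hasDerivAt_coshSeries c (n + 1) (n + 1) (t - s)).comp s hr
    refine ((hl.cosh.mul h1).add ((hl.sinh.const_mul c).mul h2)).neg.congr_deriv ?_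
    rw [← coshSeries_succ_sub c n n]
    simp only [Function.comp_apply]
    ring
  rw [intervalIntegral.integral_eq_sub_of_hasDerivAt hder]
  · simp [coshSeries_succ_zero]
  · apply Continuous.intervalIntegrable
    have := continuous_coshSeries_self c n
    fun_prop

lemma iterInt_cosh_eq_coshSeries (c : ℝ) (n : ℕ) (a t : ℝ) :
    iterInt (fun u => Real.cosh (c * u)) n a t = coshSeries c n n (t - a) := by
  induction n generalizing a with
  | zero => simp [iterInt, coshSeries_zero_zero]
  | succ n ih => simp only [iterInt, ih, integral_cosh_mul_coshSeries]

end Series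

/-- Both parity classes of the expansion, written as one sum. -/
lemma sum_half_tsum_eq (n : ℕ) (y : ℝ) :
    ∑ k ∈ Finset.range (n + 1), (1 / 2 ^ n) * ((n.factorial : ℝ) / ((n - k).factorial : ℝ)) *
        ∑' j : ℕ, ((k / 2 + j).choose j : ℝ) * y ^ (2 * j) / ((k + 2 * j).factorial : ℝ)
      = n.factorial *
        ∑' j : ℕ, ((n + j).choose j : ℝ) * y ^ (2 * j) / ((n + 2 * j).factorial : ℝ) := by
  simp only [← tsum_mul_left]
  rw [← Summable.tsum_finsetSum fun k _ =>
    (summable_choose_mul_pow_div_factorial (k / 2) k y).mul_left _]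
  refine tsum_congr fun j => ?_
  calc _ = n.factorial * y ^ (2 * j) / 2 ^ n * ∑ k ∈ Finset.range (n + 1),
        ((k / 2 + j).choose j : ℝ) / (((n - k).factorial : ℝ) * ((k + 2 * j).factorial : ℝ)) := by
        rw [Finset.mul_sum]
        refine Finset.sum_congr rfl fun k _ => ?_
        field_simp
    _ = _ := by
        rw [sum_choose_half_div_factorial]
        field_simp

/-- explicit series expression for the conditional mean `E_n(t)`. -/
theorem conditional_mean_series (c : ℝ) (hc : 0 < c) (n : ℕ) (hn : 1 ≤ n)
    (t : ℝ) (ht : 0 < t) :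
    En c n t =
      (∑ r ∈ Finset.range (n / 2 + 1),
        (1 / 2 ^ n) * ((n.factorial : ℝ) / ((n - 2 * r).factorial : ℝ)) *
          ∑' j : ℕ, ((r + j).choose j : ℝ) * (c * t) ^ (2 * j) / ((2 * r + 2 * j).factorial : ℝ))
      + (∑ r ∈ Finset.range ((n - 1) / 2 + 1),
        (1 / 2 ^ n) * ((n.factorial : ℝ) / ((n - 2 * r - 1).factorial : ℝ)) *
          ∑' j : ℕ, ((r + j).choose j : ℝ) * (c * t) ^ (2 * j)
            / ((2 * r + 2 * j + 1).factorial : ℝ)) := by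
  have hsplit := sum_range_eq_even_add_odd (fun k => (1 / 2 ^ n) *
    ((n.factorial : ℝ) / ((n - k).factorial : ℝ)) *
      ∑' j : ℕ, ((k / 2 + j).choose j : ℝ) * (c * t) ^ (2 * j) / ((k + 2 * j).factorial : ℝ)) (n + 1)
  rw [sum_half_tsum_eq, show (n + 1 + 1) / 2 = n / 2 + 1 by omega,
    show (n + 1) / 2 = (n - 1) / 2 + 1 by omega] at hsplit
  have hodd (r : ℕ) : (2 * r + 1) / 2 = r := by omega
  have hshift (r j : ℕ) : 2 * r + 1 + 2 * j = 2 * r + 2 * j + 1 := by ring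
  simp only [Nat.mul_div_cancel_left _ Nat.two_pos, hodd, hshift, ← Nat.sub_sub] at hsplit
  rw [← hsplit, En, iterInt_cosh_eq_coshSeries, sub_zero, coshSeries_eq_pow_mul]
  field_simp
end
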